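/- arXiv:0704.3840 — 2 statements merged into one kernel-verified Lean document; each statement's English description precedes it below -/
import Mathlib

section
/- Let K have characteristic zero and X be a K-vector space. On S(X) = ∏_{m≥0} X[X]_m (formal series with variables and coefficients in X), define for ξ, η ∈ S(X) the bracket [ξ,η] = ξη − ηξ, where ξη is the derivative of η along ξ: its degree-s component is Σ_{r+m−1=s} ξ_r η_m, with (ξ_r η_m)(x) the sum over insertions of ξ_r(x) into one slot of a multilinear map determining η_m. Then S(X) with this bracket is a Lie algebra over K. -/
open Finset
open scoped Nat

/-- `f : E → F` is a homogeneous polynomial of degree `m` with variables in `E`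
and coefficients in `F`: it is determined by some `m`-multilinear map. -/
def IsHomog (K : Type*) [Field K] {E F : Type*} [AddCommGroup E] [Module K E]
    [AddCommGroup F] [Module K F] (m : ℕ) (f : E → F) : Prop :=
  ∃ u : MultilinearMap K (fun _ : Fin m => E) F, ∀ x, f x = u fun _ => x

/-- A formal series with variables in `X` and coefficients in `F`, presented by a
family of multilinear maps determining its homogeneous components. -/
abbrev MSeries (K : Type*) [Field K] (X F : Type*) [AddCommGroup X] [Module K X]
    [AddCommGroup F] [Module K F] :=
  ∀ m : ℕ, MultilinearMap K (fun _ : Fin m => X) F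

/-- The homogeneous components (as functions) of a presented formal series. -/
def evalS {K : Type*} [Field K] {X F : Type*} [AddCommGroup X] [Module K X]
    [AddCommGroup F] [Module K F] (f : MSeries K X F) : ℕ → X → F :=
  fun m x => f m fun _ => x

/-- Degree-`s` component of the derivative `ξ f` of the formal series `f` along the
formal series `ξ` : `g_s = Σ_{r+m-1=s} ξ_r f_m`, where `(ξ_r f_m)(x)` is the sum over
insertions of `ξ_r(x)` into one slot of a multilinear map determining `f_m`. -/
def dcomp {K : Type*} [Field K] {X F : Type*} [AddCommGroup X] [Module K X]
    [AddCommGroup F] [Module K F]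
    (ξ : MSeries K X X) (f : MSeries K X F) (s : ℕ) (x : X) : F :=
  ∑ r ∈ Finset.range (s + 2), ∑ i : Fin (s + 1 - r),
    f (s + 1 - r) (Function.update (fun _ => x) i (ξ r fun _ => x))

/-- The bracket `[ξ,η] = ξη - ηξ` on `S(X)`, at the level of components. -/
def br {K : Type*} [Field K] {X : Type*} [AddCommGroup X] [Module K X]
    (ξ η : MSeries K X X) (s : ℕ) (x : X) : X :=
  dcomp ξ η s x - dcomp η ξ s x

/-- The pointwise bracket on `A[[Y]]` (component functions) induced by the bracket of
the Lie algebra `A` : `[f,g]_s (y) = Σ_{n+r=s} [f_n(y), g_r(y)]`. -/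
def PBr {Y A : Type*} [LieRing A] (f g : ℕ → Y → A) (s : ℕ) (y : Y) : A :=
  ∑ n ∈ Finset.range (s + 1), ⁅f n y, g (s - n) y⁆

/-- Components of the fundamental action of a Lie algebra `B` on itself:
`d_b` has degree-`n` component `y ↦ t_n (ad y)^n (b)`. -/
def fd {K : Type*} [Field K] {B : Type*} [LieRing B] [LieAlgebra K B]
    (t : ℕ → K) (b : B) : ℕ → B → B :=
  fun n y => t n • ((LieAlgebra.ad K B y ^ n) b)

/-- The generating-series condition `Σ t_n T^n = T e^T / (e^T - 1)`, i.e.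
`(Σ t_n T^n) (e^T - 1) = T e^T`. -/
def GenFun (K : Type*) [Field K] [CharZero K] (t : ℕ → K) : Prop :=
  PowerSeries.mk t * (PowerSeries.exp K - 1) = PowerSeries.X * PowerSeries.exp K

section Helpers

variable {K : Type*} [Field K] {X F : Type*} [AddCommGroup X] [Module K X]
    [AddCommGroup F] [Module K F]

/-- The tuple with `a` in slot `i` and `z` elsewhere. -/
def insTup {ι : Type*} [DecidableEq ι] (i : ι) (a : X) (z : {j : ι // j ≠ i} → X) : ι → X :=
  fun j => if h : j = i then a else z ⟨j, h⟩

lemma insTup_eq_update {ι : Type*} [DecidableEq ι] (i : ι) (a : X) (z : {j : ι // j ≠ i} → X) :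
    insTup i a z = Function.update (insTup i 0 z) i a := by
  funext j
  by_cases h : j = i
  · subst h; simp [insTup]
  · simp [insTup, h]

lemma insTup_update {ι : Type*} [DecidableEq ι] (i : ι) (a : X) (z : {j : ι // j ≠ i} → X)
    (k : {j : ι // j ≠ i}) (v : X) :
    insTup i a (Function.update z k v) = Function.update (insTup i a z) k.1 v := by
  funext j
  by_cases h : j = i
  · subst h
    have : j ≠ k.1 := fun e => k.2 e.symm
    simp [insTup, Function.update_apply, this]
  · simp [insTup, h, Function.update_apply, Subtype.ext_iff]

lemma insTup_const {ι : Type*} [DecidableEq ι] (i : ι) (a x : X) :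
    insTup i a (fun _ => x) = Function.update (fun _ => x) i a := by
  funext j
  by_cases h : j = i
  · subst h; simp [insTup]
  · simp [insTup, h]

/-- Insert the multilinear map `w` into the slot `i` of the multilinear map `u`. -/
def insMul {ι κ : Type*} [DecidableEq ι]
    (u : MultilinearMap K (fun _ : ι => X) F) (i : ι)
    (w : MultilinearMap K (fun _ : κ => X) X) :
    MultilinearMap K (fun _ : {j : ι // j ≠ i} ⊕ κ => X) F where
  toFun z := u (insTup i (w (fun l => z (Sum.inr l))) (fun k => z (Sum.inl k)))
  map_update_add' := by
    classical
    intro _ m k x y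
    cases k with
    | inl j =>
      have e : ∀ v : X, (fun k => Function.update m (Sum.inl j) v (Sum.inl k)) =
        Function.update (fun k => m (Sum.inl k)) j v := by
        intro v; funext k; simp [Function.update_apply]
      simp [e, insTup_update]
    | inr l =>
      have e : ∀ v : X, (fun k => Function.update m (Sum.inr l) v (Sum.inr k)) =
        Function.update (fun k => m (Sum.inr k)) l v := by
        intro v; funext k; simp [Function.update_apply]
      simp only [e, MultilinearMap.map_update_add, ne_eq, reduceCtorEq, not_false_eq_true,
        Function.update_of_ne]
      rw [insTup_eq_update, MultilinearMap.map_update_add, ← insTup_eq_update, ← insTup_eq_update]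
  map_update_smul' := by
    classical
    intro _ m k c x
    cases k with
    | inl j =>
      have e : ∀ v : X, (fun k => Function.update m (Sum.inl j) v (Sum.inl k)) =
        Function.update (fun k => m (Sum.inl k)) j v := by
        intro v; funext k; simp [Function.update_apply]
      simp [e, insTup_update]
    | inr l =>
      have e : ∀ v : X, (fun k => Function.update m (Sum.inr l) v (Sum.inr k)) =
        Function.update (fun k => m (Sum.inr k)) l v := by
        intro v; funext k; simp [Function.update_apply]
      simp only [e, MultilinearMap.map_update_smul, ne_eq, reduceCtorEq, not_false_eq_true,
        Function.update_of_ne]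
      rw [insTup_eq_update, MultilinearMap.map_update_smul, ← insTup_eq_update]

/-- First derivative at `x`, as a linear map. -/
def D1 {ι : Type*} [Fintype ι] [DecidableEq ι] (u : MultilinearMap K (fun _ : ι => X) F) (x : X) :
    X →ₗ[K] F where
  toFun v := ∑ i, u (Function.update (fun _ => x) i v)
  map_add' v w := by simp [Finset.sum_add_distrib]
  map_smul' c v := by simp [Finset.smul_sum]

/-- Second derivative at `x`. -/
def D2 {ι : Type*} [Fintype ι] [DecidableEq ι] (u : MultilinearMap K (fun _ : ι => X) F)
    (x v w : X) : F :=
  ∑ i, ∑ j, if j = i then 0 else u (Function.update (Function.update (fun _ => x) i v) j w)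

lemma D2_comm {ι : Type*} [Fintype ι] [DecidableEq ι] (u : MultilinearMap K (fun _ : ι => X) F)
    (x v w : X) : D2 u x v w = D2 u x w v := by
  unfold D2
  rw [Finset.sum_comm]
  refine Finset.sum_congr rfl fun i _ => Finset.sum_congr rfl fun j _ => ?_
  by_cases h : i = j
  · simp [h]
  · rw [if_neg h, if_neg (Ne.symm h), Function.update_comm h]

/-- `f` is homogeneous of degree `n` with derivative `f'`. -/
def HD (K : Type*) [Field K] {X F : Type*} [AddCommGroup X] [Module K X]
    [AddCommGroup F] [Module K F] (n : ℕ) (f : X → F) (f' : X → X → F) : Prop :=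
  ∃ u : MultilinearMap K (fun _ : Fin n => X) F, (∀ x, f x = u fun _ => x) ∧
    ∀ x v, f' x v = D1 u x v

lemma HD.of {ι : Type*} [Fintype ι] [DecidableEq ι] {n : ℕ} (hn : Fintype.card ι = n)
    (u : MultilinearMap K (fun _ : ι => X) F) :
    HD K n (fun x => u fun _ => x) (fun x v => D1 u x v) := by
  let e := Fintype.equivFinOfCardEq hn
  refine ⟨u.domDomCongr e, fun x => rfl, fun x v => ?_⟩
  simp only [D1, LinearMap.coe_mk, AddHom.coe_mk, MultilinearMap.domDomCongr_apply]
  refine Fintype.sum_equiv e _ _ fun i => ?_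
  congr 1
  funext k
  simp [Function.update_apply]

lemma HD.zero (n : ℕ) : HD K n (fun _ : X => (0 : F)) (fun _ _ => 0) :=
  ⟨0, fun x => by simp, fun x v => by simp [D1]⟩

lemma HD.add {n : ℕ} {f g : X → F} {f' g' : X → X → F} (hf : HD K n f f') (hg : HD K n g g') :
    HD K n (fun x => f x + g x) (fun x v => f' x v + g' x v) := by
  obtain ⟨u, hu, hu'⟩ := hf
  obtain ⟨w, hw, hw'⟩ := hg
  exact ⟨u + w, fun x => by simp [hu, hw],
    fun x v => by simp [hu', hw', D1, Finset.sum_add_distrib]⟩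

lemma HD.sub {n : ℕ} {f g : X → F} {f' g' : X → X → F} (hf : HD K n f f') (hg : HD K n g g') :
    HD K n (fun x => f x - g x) (fun x v => f' x v - g' x v) := by
  obtain ⟨u, hu, hu'⟩ := hf
  obtain ⟨w, hw, hw'⟩ := hg
  exact ⟨u - w, fun x => by simp [hu, hw],
    fun x v => by simp [hu', hw', D1, Finset.sum_sub_distrib]⟩

lemma HD.sum {α : Type*} (s : Finset α) {n : ℕ} {f : α → X → F} {f' : α → X → X → F}
    (hf : ∀ a ∈ s, HD K n (f a) (f' a)) :
    HD K n (fun x => ∑ a ∈ s, f a x) (fun x v => ∑ a ∈ s, f' a x v) := by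
  classical
  induction s using Finset.induction_on with
  | empty => simpa using HD.zero n
  | insert a s ha ih =>
    simp only [Finset.sum_insert ha]
    exact (hf a (by simp)).add (ih fun b hb => hf b (by simp [hb]))

lemma D1_insMul {ι κ : Type*} [Fintype ι] [DecidableEq ι] [Fintype κ] [DecidableEq κ]
    (u : MultilinearMap K (fun _ : ι => X) F) (i : ι)
    (w : MultilinearMap K (fun _ : κ => X) X) (x v : X) :
    D1 (insMul u i w) x v = u (Function.update (fun _ => x) i (D1 w x v)) +
      ∑ j, if j = i then 0 else
        u (Function.update (Function.update (fun _ => x) i (w fun _ => x)) j v) := by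
  have e1 : ∀ j, (fun k => Function.update (fun _ : {j : ι // j ≠ i} ⊕ κ => x) (Sum.inl j) v
      (Sum.inl k)) = Function.update (fun _ => x) j v := by
    intro j; funext k; simp [Function.update_apply]
  have e2 : ∀ l, (fun k => Function.update (fun _ : {j : ι // j ≠ i} ⊕ κ => x) (Sum.inr l) v
      (Sum.inr k)) = Function.update (fun _ => x) l v := by
    intro j; funext k; simp [Function.update_apply]
  have h1 : D1 (insMul u i w) x v =
      (∑ j : {j : ι // j ≠ i},
        u (Function.update (Function.update (fun _ => x) i (w fun _ => x)) j.1 v)) +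
      ∑ l, u (Function.update (fun _ => x) i (w (Function.update (fun _ => x) l v))) := by
    simp only [D1, LinearMap.coe_mk, AddHom.coe_mk, Fintype.sum_sum_type]
    congr 1
    · refine Finset.sum_congr rfl fun j _ => ?_
      simp only [insMul, MultilinearMap.coe_mk, e1, insTup_update]
      simp [insTup_const]
    · refine Finset.sum_congr rfl fun j _ => ?_
      simp only [insMul, MultilinearMap.coe_mk, e2]
      simp [insTup_const]
  rw [h1, add_comm]
  congr 1
  · have := (map_sum (u.toLinearMap (fun _ => x) i)
      (fun l => w (Function.update (fun _ => x) l v)) Finset.univ)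
    exact this.symm
  · have := Finset.sum_subtype (F := inferInstance) (Finset.univ.filter (· ≠ i)) (p := fun j => j ≠ i) (by simp)
      (fun j => u (Function.update (Function.update (fun _ => x) i (w fun _ => x)) j v))
    rw [← this, Finset.sum_filter]
    refine Finset.sum_congr rfl fun j _ => ?_
    by_cases h : j = i <;> simp [h]

lemma D1_eq_zero [CharZero K] {n : ℕ} (u : MultilinearMap K (fun _ : Fin n => X) F)
    (h : ∀ x, u (fun _ => x) = 0) (x v : X) : D1 u x v = 0 := by
  rw [← Module.forall_dual_apply_eq_zero_iff K]
  intro g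
  let P : Polynomial K := ∑ s : Finset (Fin n),
    Polynomial.C (g (u (s.piecewise (fun _ => v) (fun _ => x)))) * Polynomial.X ^ s.card
  have hP : P = 0 := by
    apply Polynomial.funext
    intro t
    have h1 := h (t • v + x)
    have h2 : (fun _ : Fin n => t • v + x) = (fun _ => t • v) + (fun _ => x) := rfl
    rw [h2, MultilinearMap.map_add_univ] at h1
    have h3 := congrArg g h1
    rw [map_sum, map_zero] at h3
    rw [Polynomial.eval_zero, ← h3]
    simp only [P, Polynomial.eval_finsetSum]
    refine Finset.sum_congr rfl fun s _ => ?_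
    have h4 := u.map_piecewise_smul (fun _ => t) (s.piecewise (fun _ => v) (fun _ => x)) s
    have h5 : (s.piecewise (fun i => t • (s.piecewise (fun _ => v) (fun _ => x)) i)
        (s.piecewise (fun _ => v) (fun _ => x)) : Fin n → X) =
        s.piecewise (fun _ => t • v) (fun _ => x) := by
      funext i
      by_cases hi : i ∈ s <;> simp [hi]
    rw [← h5, h4]
    simp only [Polynomial.eval_mul, Polynomial.eval_C, Polynomial.eval_pow, Polynomial.eval_X,
      Finset.prod_const, map_smul, smul_eq_mul]
    exact mul_comm _ _
  have hc : P.coeff 1 = 0 := by rw [hP]; simp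
  simp only [P, Polynomial.finsetSum_coeff, Polynomial.coeff_C_mul, Polynomial.coeff_X_pow] at hc
  rw [← hc]
  simp only [D1, LinearMap.coe_mk, AddHom.coe_mk, map_sum, mul_ite, mul_one, mul_zero]
  rw [← Finset.sum_filter]
  have : (Finset.univ.filter fun s : Finset (Fin n) => 1 = s.card) =
      Finset.univ.map ⟨fun i : Fin n => ({i} : Finset (Fin n)), Finset.singleton_injective⟩ := by
    ext s
    simp only [Finset.mem_filter, Finset.mem_univ, true_and, Finset.mem_map,
      Function.Embedding.coeFn_mk]
    rw [eq_comm, Finset.card_eq_one]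
    exact exists_congr fun a => eq_comm
  rw [this, Finset.sum_map]
  refine Finset.sum_congr rfl fun i _ => ?_
  simp [Finset.piecewise_singleton]

lemma HD.unique [CharZero K] {n : ℕ} {f : X → F} {f' g' : X → X → F}
    (hf : HD K n f f') (hg : HD K n f g') (x v : X) : f' x v = g' x v := by
  obtain ⟨u, hu, hu'⟩ := hf
  obtain ⟨w, hw, hw'⟩ := hg
  have := D1_eq_zero (u - w) (fun x => by simp [← hu, ← hw]) x v
  rw [hu', hw', ← sub_eq_zero, ← this]
  simp [D1]

lemma HD.slot {m r s : ℕ} (hs : r + m = s + 1) (hm : 0 < m)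
    (u : MultilinearMap K (fun _ : Fin m => X) F) (w : MultilinearMap K (fun _ : Fin r => X) X) :
    HD K s (fun x => D1 u x (w fun _ => x))
      (fun x v => D1 u x (D1 w x v) + D2 u x (w fun _ => x) v) := by
  have h := HD.sum (K := K) (n := s) (Finset.univ : Finset (Fin m))
    (f := fun i x => insMul u i w (fun _ => x)) (f' := fun i x v => D1 (insMul u i w) x v)
    (fun i _ => HD.of (by simp; omega) _)
  simp only [D1_insMul, Finset.sum_add_distrib] at h
  simp only [insMul, MultilinearMap.coe_mk, insTup_const] at h
  exact h

lemma D1_deg0 (u : MultilinearMap K (fun _ : Fin 0 => X) F) (x v : X) : D1 u x v = 0 := by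
  simp [D1]

lemma D2_deg0 (u : MultilinearMap K (fun _ : Fin 0 => X) F) (x v w : X) : D2 u x v w = 0 := by
  simp [D2]

lemma dcomp_eq (ξ : MSeries K X X) (f : MSeries K X F) (s : ℕ) (x : X) :
    dcomp ξ f s x = ∑ p ∈ antidiagonal (s + 1), D1 (f p.2) x (ξ p.1 fun _ => x) := by
  rw [Finset.Nat.sum_antidiagonal_eq_sum_range_succ_mk]
  rfl

lemma HD_dcomp (ξ : MSeries K X X) (f : MSeries K X F) (s : ℕ) :
    HD K s (dcomp ξ f s) (fun x v => ∑ p ∈ antidiagonal (s + 1),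
      (D1 (f p.2) x (D1 (ξ p.1) x v) + D2 (f p.2) x (ξ p.1 fun _ => x) v)) := by
  have e : dcomp ξ f s = fun x => ∑ p ∈ antidiagonal (s + 1), D1 (f p.2) x (ξ p.1 fun _ => x) :=
    funext fun x => dcomp_eq ξ f s x
  rw [e]
  refine HD.sum _ ?_
  rintro ⟨r, m⟩ hp
  rw [HasAntidiagonal.mem_antidiagonal] at hp
  rcases Nat.eq_zero_or_pos m with rfl | hm
  · simpa [D1_deg0, D2_deg0] using HD.zero s
  · exact HD.slot hp hm _ _

/-- reassociation of a triple sum -/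
lemma anti_assoc (n : ℕ) (f : ℕ → ℕ → ℕ → F) :
    ∑ p ∈ antidiagonal n, ∑ q ∈ antidiagonal p.1, f q.1 q.2 p.2 =
      ∑ p ∈ antidiagonal n, ∑ q ∈ antidiagonal p.2, f p.1 q.1 q.2 := by
  rw [Finset.sum_sigma', Finset.sum_sigma']
  refine Finset.sum_nbij' (fun a => ⟨(a.2.1, a.2.2 + a.1.2), (a.2.2, a.1.2)⟩)
    (fun a => ⟨(a.1.1 + a.2.1, a.2.2), (a.1.1, a.2.1)⟩) ?_ ?_ ?_ ?_ ?_
  · rintro ⟨⟨a, b⟩, ⟨c, d⟩⟩; simp; omega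
  · rintro ⟨⟨a, b⟩, ⟨c, d⟩⟩; simp; omega
  · rintro ⟨⟨a, b⟩, ⟨c, d⟩⟩; simp +contextual
  · rintro ⟨⟨a, b⟩, ⟨c, d⟩⟩; simp +contextual
  · rintro ⟨⟨a, b⟩, ⟨c, d⟩⟩; simp

/-- `Σ Dc_k (Db_j (a_i))` over `i + j + k = n`. -/
def TT (a b c : MSeries K X X) (n : ℕ) (x : X) : X :=
  ∑ p ∈ antidiagonal n, ∑ q ∈ antidiagonal p.2,
    D1 (c q.2) x (D1 (b q.1) x (a p.1 fun _ => x))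

/-- `Σ D²c_k (b_j, a_i)` over `i + j + k = n`. -/
def QQ (a b c : MSeries K X X) (n : ℕ) (x : X) : X :=
  ∑ p ∈ antidiagonal n, ∑ q ∈ antidiagonal p.2,
    D2 (c q.2) x (b q.1 fun _ => x) (a p.1 fun _ => x)

lemma QQ_comm (a b c : MSeries K X X) (n : ℕ) (x : X) : QQ a b c n x = QQ b a c n x := by
  unfold QQ
  rw [← anti_assoc n (fun i j k => D2 (c k) x (b j fun _ => x) (a i fun _ => x)),
    ← anti_assoc n (fun i j k => D2 (c k) x (a j fun _ => x) (b i fun _ => x))]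
  refine Finset.sum_congr rfl fun p _ => ?_
  rw [← Finset.Nat.sum_antidiagonal_swap]
  refine Finset.sum_congr rfl fun q _ => ?_
  exact D2_comm _ _ _ _

/-- derivative along a bracket -/
lemma dcomp_br (ξ η ζ θ : MSeries K X X) (h : ∀ s x, evalS θ s x = br ξ η s x) (s : ℕ) (x : X) :
    dcomp θ ζ s x = TT ξ η ζ (s + 2) x - TT η ξ ζ (s + 2) x := by
  have key : ∀ a b : MSeries K X X, TT a b ζ (s + 2) x =
      ∑ p ∈ antidiagonal (s + 1), D1 (ζ p.2) x (dcomp a b p.1 x) := by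
    intro a b
    unfold TT
    rw [← anti_assoc (s + 2) (fun i j k => D1 (ζ k) x (D1 (b j) x (a i fun _ => x))),
      Finset.Nat.sum_antidiagonal_succ]
    simp [D1_deg0, dcomp_eq]
  rw [key, key, dcomp_eq, ← Finset.sum_sub_distrib]
  refine Finset.sum_congr rfl fun p _ => ?_
  rw [← map_sub]
  congr 1
  exact h p.1 x

/-- derivative of a bracket -/
lemma br_dcomp [CharZero K] (ξ η ζ θ : MSeries K X X) (h : ∀ s x, evalS θ s x = br ξ η s x)
    (s : ℕ) (x : X) :
    dcomp ζ θ s x = (TT ζ ξ η (s + 2) x + QQ ζ ξ η (s + 2) x)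
      - (TT ζ η ξ (s + 2) x + QQ ζ η ξ (s + 2) x) := by
  have hD : ∀ n x v, D1 (θ n) x v =
      (∑ p ∈ antidiagonal (n + 1),
        (D1 (η p.2) x (D1 (ξ p.1) x v) + D2 (η p.2) x (ξ p.1 fun _ => x) v)) -
      ∑ p ∈ antidiagonal (n + 1),
        (D1 (ξ p.2) x (D1 (η p.1) x v) + D2 (ξ p.2) x (η p.1 fun _ => x) v) := by
    intro n
    refine HD.unique (f := evalS θ n) ⟨θ n, fun _ => rfl, fun _ _ => rfl⟩ ?_
    have := (HD_dcomp ξ η n).sub (HD_dcomp η ξ n)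
    convert this using 1
    funext x
    exact h n x
  have key : ∀ a b : MSeries K X X, TT ζ a b (s + 2) x + QQ ζ a b (s + 2) x =
      ∑ q ∈ antidiagonal (s + 1), ∑ p ∈ antidiagonal (q.2 + 1),
        (D1 (b p.2) x (D1 (a p.1) x (ζ q.1 fun _ => x))
          + D2 (b p.2) x (a p.1 fun _ => x) (ζ q.1 fun _ => x)) := by
    intro a b
    unfold TT QQ
    rw [← Finset.sum_add_distrib, Finset.Nat.sum_antidiagonal_succ']
    simp [D1_deg0, D2_deg0, Finset.sum_add_distrib]
  rw [key, key, dcomp_eq, ← Finset.sum_sub_distrib]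
  exact Finset.sum_congr rfl fun p _ => hD _ _ _

lemma dcomp_add_left (ξ ξ' : MSeries K X X) (f : MSeries K X F) (s : ℕ) (x : X) :
    dcomp (ξ + ξ') f s x = dcomp ξ f s x + dcomp ξ' f s x := by
  simp [dcomp_eq, Finset.sum_add_distrib]

lemma dcomp_add_right (ξ : MSeries K X X) (f f' : MSeries K X F) (s : ℕ) (x : X) :
    dcomp ξ (f + f') s x = dcomp ξ f s x + dcomp ξ f' s x := by
  simp [dcomp, Finset.sum_add_distrib]

lemma dcomp_smul_left (c : K) (ξ : MSeries K X X) (f : MSeries K X F) (s : ℕ) (x : X) :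
    dcomp (c • ξ) f s x = c • dcomp ξ f s x := by
  simp [dcomp_eq, Finset.smul_sum]

lemma dcomp_smul_right (c : K) (ξ : MSeries K X X) (f : MSeries K X F) (s : ℕ) (x : X) :
    dcomp ξ (c • f) s x = c • dcomp ξ f s x := by
  simp [dcomp, Finset.smul_sum]

end Helpers

/-- `S(X)` with the bracket `[ξ,η] = ξη - ηξ` is a Lie algebra over `K` :
its components are again in `S(X)` (homogeneous of the right degree), the bracket is
bilinear, alternating, antisymmetric, and satisfies the Jacobi identity (the brackets
being formal series, the iterated brackets are computed through any multilinear
presentations `θᵢ` of the inner brackets, which is legitimate by independence of the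
presentation). -/
theorem stmt3 (K : Type*) [Field K] [CharZero K] (X : Type*) [AddCommGroup X] [Module K X] :
    (∀ ξ η : MSeries K X X, ∀ s : ℕ, IsHomog K s (fun x => br ξ η s x)) ∧
    (∀ ξ : MSeries K X X, ∀ s x, br ξ ξ s x = 0) ∧
    (∀ ξ η : MSeries K X X, ∀ s x, br ξ η s x = - br η ξ s x) ∧
    (∀ ξ ξ' η : MSeries K X X, ∀ s x, br (ξ + ξ') η s x = br ξ η s x + br ξ' η s x) ∧
    (∀ (c : K) (ξ η : MSeries K X X), ∀ s x, br (c • ξ) η s x = c • br ξ η s x) ∧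
    (∀ ξ η ζ θ₁ θ₂ θ₃ : MSeries K X X,
      (∀ s x, evalS θ₁ s x = br ξ η s x) →
      (∀ s x, evalS θ₂ s x = br η ζ s x) →
      (∀ s x, evalS θ₃ s x = br ζ ξ s x) →
      ∀ s x, br θ₁ ζ s x + br θ₂ ξ s x + br θ₃ η s x = 0) := by
  refine ⟨?_, ?_, ?_, ?_, ?_, ?_⟩
  · intro ξ η s
    obtain ⟨u, hu, -⟩ := (HD_dcomp ξ η s).sub (HD_dcomp η ξ s)
    exact ⟨u, hu⟩
  · intro ξ s x
    simp [br]
  · intro ξ η s x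
    simp [br]
  · intro ξ ξ' η s x
    simp only [br, dcomp_add_left, dcomp_add_right]
    abel
  · intro c ξ η s x
    simp only [br, dcomp_smul_left, dcomp_smul_right, smul_sub]
  · intro ξ η ζ θ₁ θ₂ θ₃ h₁ h₂ h₃ s x
    simp only [br]
    rw [dcomp_br ξ η ζ θ₁ h₁, dcomp_br η ζ ξ θ₂ h₂, dcomp_br ζ ξ η θ₃ h₃,
      br_dcomp ξ η ζ θ₁ h₁, br_dcomp η ζ ξ θ₂ h₂, br_dcomp ζ ξ η θ₃ h₃,
      QQ_comm ζ ξ η, QQ_comm ζ η ξ, QQ_comm ξ η ζ]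
    abel
end

section
/- Let K have characteristic zero and B a Lie algebra over K. Define d : B → S(B) by letting d_b be the formal series with degree-n component y ↦ t_n (ad y)^n(b), where Σ t_n T^n = T e^T/(e^T − 1). Then d is a Lie algebra homomorphism, i.e., d_{[b,b']} = [d_b, d_{b'}] in the Lie algebra S(B) of formal series on B. (This d is called the fundamental action of B on itself.) -/
open Finset
open scoped Nat

/-- If a multilinear map vanishes on the diagonal, so does its derivative. -/
lemma sum_update_eq_zero {K : Type*} [Field K] [CharZero K] {E F : Type*} [AddCommGroup E]
    [Module K E] [AddCommGroup F] [Module K F] {m : ℕ}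
    (w : MultilinearMap K (fun _ : Fin m => E) F) (hw : ∀ x, w (fun _ => x) = 0) (y c : E) :
    ∑ i, w (Function.update (fun _ => y) i c) = 0 := by
  classical
  rw [← Module.forall_dual_apply_eq_zero_iff K]
  intro f
  let P : Polynomial K := ∑ S : Finset (Fin m),
    Polynomial.monomial S.card (f (w (S.piecewise (fun _ => c) (fun _ => y))))
  have hP : P = 0 := by
    apply Polynomial.funext
    intro e
    have h := hw (e • c + y)
    have h2 := w.map_add_univ (fun _ => e • c) (fun _ => y)
    have h3 : ((fun _ : Fin m => e • c) + fun _ => y) = fun _ => e • c + y := rfl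
    rw [h3, h] at h2
    have h4 := congrArg f h2
    rw [map_zero, map_sum] at h4
    simp only [P, Polynomial.eval_finsetSum, Polynomial.eval_monomial, Polynomial.eval_zero]
    rw [h4]
    refine Finset.sum_congr rfl fun S _ => ?_
    have h5 := w.map_piecewise_smul (fun _ => e) (S.piecewise (fun _ => c) (fun _ => y)) S
    have h6 : (S.piecewise (fun i => (fun _ => e) i • (S.piecewise (fun _ => c) (fun _ => y)) i)
        (S.piecewise (fun _ => c) (fun _ => y)) : Fin m → E)
        = S.piecewise (fun _ => e • c) (fun _ => y) := by
      ext i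
      by_cases hi : i ∈ S <;> simp [hi]
    rw [h6] at h5
    rw [h5]
    simp [mul_comm]
  have h1 : P.coeff 1 = 0 := by rw [hP]; simp
  simp only [P, Polynomial.finsetSum_coeff, Polynomial.coeff_monomial] at h1
  rw [← Finset.sum_filter] at h1
  rw [map_sum, ← h1]
  symm
  refine Finset.sum_bij' (i := fun S hS => (Finset.card_eq_one.1 (Finset.mem_filter.1 hS).2).choose)
    (j := fun i _ => {i}) ?_ ?_ ?_ ?_ ?_
  · intros; simp
  · intros; simp
  · intro S hS
    exact (Finset.card_eq_one.1 (Finset.mem_filter.1 hS).2).choose_spec.symm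
  · intro i hi
    have := (Finset.card_eq_one.1 (Finset.card_singleton i)).choose_spec
    exact (Finset.singleton_injective this).symm
  · intro S hS
    have := (Finset.card_eq_one.1 (Finset.mem_filter.1 hS).2).choose_spec
    generalize (Finset.card_eq_one.1 (Finset.mem_filter.1 hS).2).choose = i at this ⊢
    subst this
    rw [Finset.piecewise_singleton]

/-- Derivative of the `m`-th power, at `A` along `C`. -/
def Dpow {R : Type*} [Ring R] (A C : R) : ℕ → R
  | 0 => 0
  | m + 1 => C * A ^ m + A * Dpow A C m

lemma sum_prod_update {R : Type*} [Ring R] (A C : R) (m : ℕ) :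
    ∑ i : Fin m, (List.ofFn (Function.update (fun _ : Fin m => A) i C)).prod = Dpow A C m := by
  induction m with
  | zero => simp [Dpow]
  | succ m ih =>
    rw [Fin.sum_univ_succ, Dpow, ← ih, Finset.mul_sum]
    congr 1
    · simp [List.ofFn_succ, List.ofFn_const]
    · refine Finset.sum_congr rfl fun i _ => ?_
      rw [List.ofFn_succ, List.prod_cons]
      rw [Function.update_of_ne (Fin.succ_ne_zero i).symm]
      congr 3
      ext j
      simp [Function.update_apply]

lemma sum_update_fd {K : Type*} [Field K] [CharZero K] {B : Type*} [LieRing B] [LieAlgebra K B]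
    (t : ℕ → K) (b : B) (ξ : MSeries K B B) (hξ : ∀ n y, evalS ξ n y = fd t b n y)
    (m : ℕ) (y c : B) :
    ∑ i, ξ m (Function.update (fun _ => y) i c)
      = t m • (Dpow (LieAlgebra.ad K B y) (LieAlgebra.ad K B c) m) b := by
  let v : MultilinearMap K (fun _ : Fin m => B) B :=
    t m • (LinearMap.applyₗ (R := K) b).compMultilinearMap
      ((MultilinearMap.mkPiAlgebraFin K m (Module.End K B)).compLinearMap
        (fun _ => (LieAlgebra.ad K B : B →ₗ[K] Module.End K B)))
  have hv : ∀ x : Fin m → B, v x = t m • (List.ofFn (fun i => LieAlgebra.ad K B (x i))).prod b := by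
    intro x
    simp [v]
  have h := sum_update_eq_zero (ξ m - v) (by
    intro x
    rw [sub_apply, hv]
    have := hξ m x
    simp only [evalS, fd] at this
    rw [this]
    simp [List.ofFn_const]) y c
  simp only [sub_apply, Finset.sum_sub_distrib] at h
  rw [sub_eq_zero.1 h, ← sum_prod_update]
  simp only [hv, ← Finset.smul_sum, LinearMap.sum_apply]
  congr 1
  refine Finset.sum_congr rfl fun i _ => ?_
  congr 3
  ext j
  by_cases hj : j = i <;> simp [Function.update_apply, hj]

/-- `H m = Σ (X+Y)^i Y^(m-1-i)` -/
def Hpol {R : Type*} [CommRing R] (z w : R) : ℕ → R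
  | 0 => 0
  | m + 1 => w ^ m + z * Hpol z w m

lemma Hpol_mul {R : Type*} [CommRing R] (z w : R) (m : ℕ) :
    (z - w) * Hpol z w m = z ^ m - w ^ m := by
  induction m with
  | zero => simp [Hpol]
  | succ m ih => rw [Hpol]; linear_combination z * ih

open MvPolynomial in
/-- `X^p Y^q ↦ [A^p b, A^q b']`. -/
noncomputable def Phi (K : Type*) [Field K] {B : Type*} [LieRing B] [LieAlgebra K B]
    (A : Module.End K B) (b b' : B) : MvPolynomial (Fin 2) K →ₗ[K] B :=
  (basisMonomials (Fin 2) K).constr K (fun m => ⁅(A ^ m 0) b, (A ^ m 1) b'⁆)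

section
open MvPolynomial
variable {K : Type*} [Field K] {B : Type*} [LieRing B] [LieAlgebra K B]

lemma Phi_monomial (A : Module.End K B) (b b' : B) (m : Fin 2 →₀ ℕ) :
    Phi K A b b' (monomial m 1) = ⁅(A ^ m 0) b, (A ^ m 1) b'⁆ := by
  have h := (basisMonomials (Fin 2) K).constr_basis K
    (fun m => (⁅(A ^ m 0) b, (A ^ m 1) b'⁆ : B)) m
  rw [coe_basisMonomials] at h
  exact h

lemma Phi_XY (A : Module.End K B) (b b' : B) (p q : ℕ) :
    Phi K A b b' (X 0 ^ p * X 1 ^ q) = ⁅(A ^ p) b, (A ^ q) b'⁆ := by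
  have : (X 0 ^ p * X 1 ^ q : MvPolynomial (Fin 2) K)
      = monomial (Finsupp.single 0 p + Finsupp.single 1 q) 1 := by
    rw [X_pow_eq_monomial, X_pow_eq_monomial, monomial_mul, one_mul]
  rw [this, Phi_monomial]
  simp

lemma Phi_mul (y b b' : B) (p : MvPolynomial (Fin 2) K) :
    Phi K (LieAlgebra.ad K B y) b b' ((X 0 + X 1) * p)
      = ⁅y, Phi K (LieAlgebra.ad K B y) b b' p⁆ := by
  have : (Phi K (LieAlgebra.ad K B y) b b').comp (LinearMap.mulLeft K (X 0 + X 1))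
      = (LieAlgebra.ad K B y).comp (Phi K (LieAlgebra.ad K B y) b b') := by
    apply (basisMonomials (Fin 2) K).ext
    intro m
    simp only [coe_basisMonomials, LinearMap.comp_apply, LinearMap.mulLeft_apply,
      LieAlgebra.ad_apply]
    rw [Phi_monomial, add_mul, map_add]
    simp only [X, monomial_mul, one_mul, Phi_monomial]
    rw [leibniz_lie y]
    simp [pow_add, pow_one]
  exact LinearMap.congr_fun this p

lemma Phi_left (y b b' : B) (r m : ℕ) :
    Dpow (LieAlgebra.ad K B y) (LieAlgebra.ad K B ((LieAlgebra.ad K B y ^ r) b)) m b'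
      = Phi K (LieAlgebra.ad K B y) b b' (Hpol (X 0 + X 1) (X 1) m * X 0 ^ r) := by
  induction m with
  | zero => simp [Dpow, Hpol]
  | succ m ih =>
    rw [Dpow, Hpol, add_mul, map_add, mul_assoc, Phi_mul, ← ih, mul_comm (X 1 ^ m), Phi_XY]
    simp

lemma Phi_right (y b b' : B) (r m : ℕ) :
    Dpow (LieAlgebra.ad K B y) (LieAlgebra.ad K B ((LieAlgebra.ad K B y ^ r) b')) m b
      = - Phi K (LieAlgebra.ad K B y) b b' (Hpol (X 0 + X 1) (X 0) m * X 1 ^ r) := by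
  induction m with
  | zero => simp [Dpow, Hpol]
  | succ m ih =>
    rw [Dpow, Hpol, add_mul, map_add, mul_assoc, Phi_mul, Phi_XY]
    simp [ih, add_comm]

lemma Phi_pow (y b b' : B) (s : ℕ) :
    Phi K (LieAlgebra.ad K B y) b b' ((X 0 + X 1) ^ s) = (LieAlgebra.ad K B y ^ s) ⁅b, b'⁆ := by
  induction s with
  | zero => simpa using Phi_XY (LieAlgebra.ad K B y) b b' 0 0
  | succ s ih => rw [pow_succ', Phi_mul, ih, pow_succ']; simp

lemma dcomp_eq_s10 [CharZero K] (t : ℕ → K) (b b' : B) (ξ ξ' : MSeries K B B)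
    (hξ : ∀ n y, evalS ξ n y = fd t b n y)
    (hξ' : ∀ n y, evalS ξ' n y = fd t b' n y) (s : ℕ) (y : B) :
    dcomp ξ ξ' s y = ∑ r ∈ Finset.range (s + 2), (t r * t (s + 1 - r)) •
      Dpow (LieAlgebra.ad K B y) (LieAlgebra.ad K B ((LieAlgebra.ad K B y ^ r) b)) (s + 1 - r) b' := by
  rw [dcomp]
  refine Finset.sum_congr rfl fun r _ => ?_
  have h1 := hξ r y
  simp only [evalS, fd] at h1
  rw [sum_update_fd t b' ξ' hξ', h1]
  have : ∀ (k : K) (A C : Module.End K B) (m : ℕ), Dpow A (k • C) m = k • Dpow A C m := by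
    intro k A C m
    induction m with
    | zero => simp [Dpow]
    | succ m ih => simp [Dpow, ih]
  rw [map_smul, this, LinearMap.smul_apply, smul_smul, mul_comm]

/-- The power series identity. -/
lemma series_identity {R : Type*} [CommRing R] [IsDomain R] [Algebra ℚ R] (F : PowerSeries R)
    (hF : F * (PowerSeries.exp R - 1) = PowerSeries.X * PowerSeries.exp R) (x y : R)
    (hx : x ≠ 0) (hy : y ≠ 0) (hxy : x + y ≠ 0) :
    PowerSeries.X * (PowerSeries.C x * PowerSeries.C y * PowerSeries.rescale (x + y) F)
      = PowerSeries.C y * (PowerSeries.rescale x F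
          * (PowerSeries.rescale (x + y) F - PowerSeries.rescale y F))
        + PowerSeries.C x * (PowerSeries.rescale y F
          * (PowerSeries.rescale (x + y) F - PowerSeries.rescale x F)) := by
  have key : ∀ a : R, PowerSeries.rescale a F * (PowerSeries.rescale a (PowerSeries.exp R) - 1)
      = PowerSeries.C a * PowerSeries.X * PowerSeries.rescale a (PowerSeries.exp R) := by
    intro a
    have := congrArg (PowerSeries.rescale a) hF
    simpa [PowerSeries.rescale_X] using this
  have ne : ∀ a : R, a ≠ 0 → PowerSeries.rescale a (PowerSeries.exp R) - 1 ≠ 0 := by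
    intro a ha h
    have := congrArg (PowerSeries.coeff 1) h
    simp [PowerSeries.coeff_rescale, PowerSeries.coeff_exp, PowerSeries.coeff_one] at this
    exact ha this
  have hadd := PowerSeries.exp_mul_exp_eq_exp_add (A := R) x y
  have kx := key x
  have ky := key y
  have kz := key (x + y)
  have nx := ne x hx
  have ny := ne y hy
  have nz := ne _ hxy
  rw [← hadd] at kz nz
  rw [map_add] at kz
  generalize PowerSeries.rescale (x + y) F = Fz at *
  generalize PowerSeries.rescale x F = Fx at *
  generalize PowerSeries.rescale y F = Fy at *
  generalize PowerSeries.rescale x (PowerSeries.exp R) = u at *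
  generalize PowerSeries.rescale y (PowerSeries.exp R) = v at *
  generalize PowerSeries.C x = x at *
  generalize PowerSeries.C y = y at *
  generalize (PowerSeries.X : PowerSeries R) = T at *
  apply mul_left_cancel₀ (mul_ne_zero (mul_ne_zero nx ny) nz)
  have e1 : (u - 1) * (v - 1) * (Fx * Fy) = x * T * u * (y * T * v) := by
    rw [← kx, ← ky]; ring
  linear_combination (-(u * v - 1) * Fz * y * (v - 1)) * kx
    + (-(u * v - 1) * Fz * x * (u - 1)) * ky + (u * v - 1) * (x + y) * e1
    + (x * y * T * ((u - 1) * (v - 1) - u * (v - 1) - v * (u - 1))) * kz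

lemma poly_identity [CharZero K] (t : ℕ → K) (ht : GenFun K t) (s : ℕ) :
    (∑ r ∈ Finset.range (s + 2), (t r * t (s + 1 - r)) •
        (Hpol (X 0 + X 1) (X 1) (s + 1 - r) * X 0 ^ r : MvPolynomial (Fin 2) K))
      + ∑ r ∈ Finset.range (s + 2), (t r * t (s + 1 - r)) •
        (Hpol (X 0 + X 1) (X 0) (s + 1 - r) * X 1 ^ r : MvPolynomial (Fin 2) K)
      = t s • (X 0 + X 1) ^ s := by
  have hx : (X 0 : MvPolynomial (Fin 2) K) ≠ 0 := X_ne_zero 0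
  have hy : (X 1 : MvPolynomial (Fin 2) K) ≠ 0 := X_ne_zero 1
  have hxy : (X 0 + X 1 : MvPolynomial (Fin 2) K) ≠ 0 := by
    intro h
    have := congrArg (MvPolynomial.eval ![1, 0]) h
    simp at this
  have hF : (PowerSeries.mk t).map (C : K →+* MvPolynomial (Fin 2) K)
      * (PowerSeries.exp _ - 1) = PowerSeries.X * PowerSeries.exp _ := by
    have := congrArg (PowerSeries.map (C : K →+* MvPolynomial (Fin 2) K)) ht
    simpa [PowerSeries.map_exp] using this
  have h := congrArg (PowerSeries.coeff (s + 1)) (series_identity _ hF (X 0) (X 1) hx hy hxy)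
  apply mul_left_cancel₀ (mul_ne_zero hx hy)
  rw [mul_assoc, PowerSeries.coeff_succ_X_mul] at h
  simp only [map_add, PowerSeries.coeff_C_mul] at h
  simp only [PowerSeries.coeff_mul, Finset.Nat.sum_antidiagonal_eq_sum_range_succ_mk, map_sub,
    PowerSeries.coeff_rescale, PowerSeries.coeff_map, PowerSeries.coeff_mk] at h
  rw [smul_eq_C_mul]
  have h' := h
  rw [mul_comm ((X 0 + X 1) ^ s)] at h'
  rw [← mul_assoc] at h'
  rw [h', mul_add, Finset.mul_sum, Finset.mul_sum, Finset.mul_sum, Finset.mul_sum]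
  congr 1
  · refine Finset.sum_congr rfl fun r _ => ?_
    have := Hpol_mul (X 0 + X 1 : MvPolynomial (Fin 2) K) (X 1) (s + 1 - r)
    rw [smul_eq_C_mul, C_mul]
    linear_combination (X 1 * C (t r) * C (t (s + 1 - r)) * X 0 ^ r) * this
  · refine Finset.sum_congr rfl fun r _ => ?_
    have := Hpol_mul (X 0 + X 1 : MvPolynomial (Fin 2) K) (X 0) (s + 1 - r)
    rw [smul_eq_C_mul, C_mul]
    linear_combination (X 0 * C (t r) * C (t (s + 1 - r)) * X 1 ^ r) * this

end

/-- the fundamental action `d : B → S(B)`, `d_b` having degree-`n`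
component `y ↦ t_n (ad y)^n(b)`, is a Lie algebra homomorphism :
`d_{[b,b']} = [d_b, d_{b'}]` in `S(B)` (the bracket being computed through any
multilinear presentations `ξ, ξ'` of `d_b` and `d_{b'}`). -/
theorem stmt10 (K : Type*) [Field K] [CharZero K] (B : Type*) [LieRing B] [LieAlgebra K B]
    (t : ℕ → K) (ht : GenFun K t) (b b' : B) (ξ ξ' : MSeries K B B)
    (hξ : ∀ n y, evalS ξ n y = fd t b n y)
    (hξ' : ∀ n y, evalS ξ' n y = fd t b' n y) :
    ∀ s y, fd t ⁅b, b'⁆ s y = br ξ ξ' s y := by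
  intro s y
  rw [br, dcomp_eq_s10 t b b' ξ ξ' hξ hξ', dcomp_eq_s10 t b' b ξ' ξ hξ' hξ]
  have h := congrArg (Phi K (LieAlgebra.ad K B y) b b') (poly_identity t ht s)
  rw [map_smul, Phi_pow, map_add, map_sum, map_sum] at h
  rw [fd, ← h]
  simp only [Phi_left y b b', Phi_right y b b', map_smul, smul_neg, Finset.sum_neg_distrib, sub_neg_eq_add]
end
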